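/- Let H be a group, k a natural number, s : Fin k → H a family whose range generates H, and m a natural number such that every element of H equals lift s w for some word w with FreeGroup.norm w ≤ m. Suppose the kernel R of the homomorphism FreeGroup (Fin k) →* H induced by s equals the normal closure in FreeGroup (Fin k) of a set of at most r elements. Let N be a finite group with center Z, let σ : Fin k → MulAut N, and set d = r·λ(|Z|). Then there exist relators w₁, …, w_d, each with FreeGroup.norm at most 3m, such that whenever (E₁, ι₁, π₁, t₁) and (E₂, ι₂, π₂, t₂) are extension data for (N, H, s) satisfying: (a) (t_j i) * ι_j a * (t_j i)⁻¹ = ι_j (σ i a) for all a ∈ N, all i, and j = 1, 2; and (c) for each l ∈ {1, …, d} there exists a ∈ N with lift t₁ (w_l) = ι₁ a and lift t₂ (w_l) = ι₂ a; there is a group isomorphism f : E₁ ≃* E₂ with f(ι₁ a) = ι₂ a for all a ∈ N. -/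

import Mathlib

/-- `λ n`: the number of prime factors of `n` counted with multiplicity. -/
def primeFactorCount (n : ℕ) : ℕ := (Nat.primeFactorsList n).length

/-- An extension datum for `(N, H, s)`: a group `E`, an injective
homomorphism `ι : N →* E` with normal range, a surjective homomorphism
`π : E →* H` with kernel equal to the range of `ι`, and lifts `t i` of the
generators `s i`. -/
def IsExtensionDatum {N H E : Type*} [Group N] [Group H] [Group E]
    {k : ℕ} (s : Fin k → H) (ι : N →* E) (π : E →* H) (t : Fin k → E) : Prop :=
  Function.Injective ι ∧ ι.range.Normal ∧ Function.Surjective π ∧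
    π.ker = ι.range ∧ ∀ i, π (t i) = s i

open scoped IsMulCommutative

open ArithmeticFunction in
/-- In a finite group, the intersection of a family of subgroups is already attained on a
subfamily whose size is the number of prime factors of the order of the group. -/
theorem exists_subfamily_forall_mem {G I : Type*} [Group G] [Nonempty I] (K : I → Subgroup G)
    (d : ℕ) (B : Subgroup G) [Finite B] (hB : cardFactors (Nat.card B) ≤ d) :
    ∃ w : Fin d → I, ∀ g ∈ B, (∀ l, g ∈ K (w l)) → ∀ i, g ∈ K i := by
  induction d generalizing B with
  | zero =>
    refine ⟨Fin.elim0, fun g hg _ i => ?_⟩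
    have h : Nat.card B = 1 := by
      have h := cardFactors_eq_zero_iff_eq_zero_or_one.mp (Nat.le_zero.mp hB)
      exact h.resolve_left Nat.card_pos.ne'
    rw [Subgroup.card_eq_one] at h
    subst h
    rw [Subgroup.mem_bot.mp hg]
    exact one_mem _
  | succ d ih =>
    by_cases hK : ∀ i, B ≤ K i
    · exact ⟨fun _ => Classical.arbitrary I, fun g hg _ i => hK i hg⟩
    push Not at hK
    obtain ⟨i, hi⟩ := hK
    have hle : B ⊓ K i ≤ B := inf_le_left
    have : Finite ↥(B ⊓ K i) := Finite.of_injective _ (Subgroup.inclusion_injective hle)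
    obtain ⟨q, hq⟩ := Subgroup.card_dvd_of_le hle
    have hpos : Nat.card B ≠ 0 := Nat.card_pos.ne'
    have hq0 : q ≠ 0 := by
      rintro rfl
      exact hpos (by simpa using hq)
    have hq1 : q ≠ 1 := by
      rintro rfl
      rw [mul_one] at hq
      exact hi (inf_eq_left.mp (Subgroup.eq_of_le_of_card_ge hle hq.le))
    have hΩq : cardFactors q ≠ 0 := by
      rw [Ne, cardFactors_eq_zero_iff_eq_zero_or_one]
      tauto
    have hΩ : cardFactors (Nat.card ↥(B ⊓ K i)) ≤ d := by
      rw [hq, cardFactors_mul Nat.card_pos.ne' hq0] at hB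
      omega
    obtain ⟨w, hw⟩ := ih (B ⊓ K i) hΩ
    refine ⟨Fin.cons i w, fun g hg h => hw g ⟨hg, ?_⟩ fun l => ?_⟩
    · simpa using h 0
    · simpa using h l.succ

/-- The homomorphisms from a normal subgroup `R` of `G` to the center of `N` which are
equivariant for the conjugation action of `G` on `R` and the action `φ` of `G` on `N`. -/
def equivariantHoms {G N : Type*} [Group G] [Group N] (R : Subgroup G) [R.Normal]
    (φ : G →* MulAut N) : Subgroup (R →* Subgroup.center N) where
  carrier := {δ | ∀ (x : G) (w : R),
    (δ (MulAut.conjNormal x w) : N) = φ x (δ w)}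
  one_mem' := fun x w => by simp
  mul_mem' := fun {a b} ha hb x w => by
    simp only [MonoidHom.mul_apply, Subgroup.coe_mul, map_mul, ha x w, hb x w]
  inv_mem' := fun {a} ha x w => by
    simp only [MonoidHom.inv_apply, Subgroup.coe_inv, map_inv, ha x w]

/-- The kernel of an equivariant homomorphism is normal in the ambient group. -/
theorem normal_map_ker_of_mem_equivariantHoms {G N : Type*} [Group G] [Group N]
    {R : Subgroup G} [R.Normal] {φ : G →* MulAut N} {δ : R →* Subgroup.center N}
    (hδ : δ ∈ equivariantHoms R φ) : (δ.ker.map R.subtype).Normal := by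
  refine ⟨?_⟩
  rintro _ ⟨w, hw, rfl⟩ x
  refine ⟨MulAut.conjNormal x w, ?_, by simp⟩
  have hw : δ w = 1 := hw
  have h := hδ x w
  rw [hw, Subgroup.coe_one, map_one] at h
  exact Subtype.ext h

theorem eq_one_of_le_map_ker {G A : Type*} [Group G] [Group A] {R : Subgroup G}
    {δ : R →* A} (h : R ≤ δ.ker.map R.subtype) : δ = 1 := by
  ext w
  obtain ⟨v, hv, hvw⟩ := h w.2
  rw [← Subtype.ext hvw]
  exact hv

/-- Evaluation of homomorphisms out of `R` at finitely many points. -/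
def evalHom {R A ι : Type*} [Group R] [CommGroup A] (e : ι → R) : (R →* A) →* (ι → A) where
  toFun δ i := δ (e i)
  map_one' := rfl
  map_mul' _ _ := rfl

theorem eq_one_of_mem_equivariantHoms {G N : Type*} [Group G] [Group N]
    {R : Subgroup G} [R.Normal] {φ : G →* MulAut N} {δ : R →* Subgroup.center N}
    (hδ : δ ∈ equivariantHoms R φ) {T : Set G} (hR : Subgroup.normalClosure T = R)
    (h : ∀ w : R, (w : G) ∈ T → δ w = 1) : δ = 1 := by
  have := normal_map_ker_of_mem_equivariantHoms hδ
  refine eq_one_of_le_map_ker ?_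
  refine hR.ge.trans (Subgroup.normalClosure_le_normal fun x hx => ?_)
  have hxR : x ∈ R := hR ▸ Subgroup.subset_normalClosure hx
  exact ⟨⟨x, hxR⟩, h ⟨x, hxR⟩ hx, rfl⟩

open ArithmeticFunction in
/-- If `R` is the normal closure of `T`, then evaluation at `T` bounds the group of
equivariant homomorphisms from `R` to the center of `N`. -/
theorem equivariantHoms_finite_and_cardFactors_le {G N : Type*} [Group G] [Group N] [Finite N]
    {R : Subgroup G} [R.Normal] (φ : G →* MulAut N) {T : Finset G}
    (hR : Subgroup.normalClosure (T : Set G) = R) :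
    Finite (equivariantHoms R φ) ∧ cardFactors (Nat.card (equivariantHoms R φ)) ≤
      T.card * cardFactors (Nat.card (Subgroup.center N)) := by
  have hT : ∀ x : T, (x : G) ∈ R := fun x => hR ▸ Subgroup.subset_normalClosure x.2
  let ev : equivariantHoms R φ →* (T → Subgroup.center N) :=
    (evalHom fun x : T => (⟨x, hT x⟩ : R)).comp (equivariantHoms R φ).subtype
  have hinj : Function.Injective ev := by
    rw [injective_iff_map_eq_one]
    intro δ h
    refine Subtype.ext (eq_one_of_mem_equivariantHoms δ.2 hR fun w hw => ?_)
    exact congrFun h ⟨w, hw⟩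
  refine ⟨Finite.of_injective ev hinj, ?_⟩
  obtain ⟨q, hq⟩ := Subgroup.card_dvd_of_injective ev hinj
  have hc : Nat.card (T → Subgroup.center N) = Nat.card (Subgroup.center N) ^ T.card := by
    rw [Nat.card_fun]
    simp
  have hpos : Nat.card (Subgroup.center N) ≠ 0 := Nat.card_pos.ne'
  have hne := pow_ne_zero T.card hpos
  rw [← hc, hq] at hne
  rw [← cardFactors_pow, ← hc, hq, cardFactors_mul (left_ne_zero_of_mul hne)
    (right_ne_zero_of_mul hne)]
  exact Nat.le_add_right _ _

/-- If every element of the image of `FreeGroup.lift s` is the value of a word of norm at most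
`m ≠ 0`, then the relators of norm at most `3 * m` generate all relators. -/
theorem ker_lift_le_of_norm_le {α H : Type*} [DecidableEq α] [Group H] (s : α → H) {m : ℕ}
    (hm0 : m ≠ 0)
    (hm : ∀ h : H, ∃ w : FreeGroup α, FreeGroup.norm w ≤ m ∧ FreeGroup.lift s w = h)
    (M : Subgroup (FreeGroup α))
    (hM : ∀ w, FreeGroup.lift s w = 1 → FreeGroup.norm w ≤ 3 * m → w ∈ M) :
    (FreeGroup.lift s).ker ≤ M := by
  choose c hcm hc using hm
  have key : ∀ (y : FreeGroup α) (h : H), c h * y * (c (h * FreeGroup.lift s y))⁻¹ ∈ M := by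
    have short : ∀ (y : FreeGroup α), FreeGroup.norm y ≤ 1 → ∀ h,
        c h * y * (c (h * FreeGroup.lift s y))⁻¹ ∈ M := by
      intro y hy h
      refine hM _ (by simp [hc]) ?_
      have h1 := FreeGroup.norm_mul_le (c h * y) (c (h * FreeGroup.lift s y))⁻¹
      have h2 := FreeGroup.norm_mul_le (c h) y
      rw [FreeGroup.norm_inv_eq] at h1
      have h3 := hcm h
      have h4 := hcm (h * FreeGroup.lift s y)
      omega
    intro y
    induction y using FreeGroup.induction_on with
    | C1 => intro h; simp
    | of x => exact short _ (by simp)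
    | inv_of x _ => exact short _ (by simp)
    | mul x y hx hy =>
      intro h
      have := mul_mem (hx h) (hy (h * FreeGroup.lift s x))
      simpa [mul_assoc] using this
  intro y hy
  have h1 : c 1 ∈ M := hM _ (hc 1) ((hcm 1).trans (by omega))
  have h2 := key y 1
  rw [MonoidHom.mem_ker.mp hy, mul_one] at h2
  exact (mul_mem_cancel_left h1).mp ((mul_mem_cancel_right (inv_mem h1)).mp h2)

section ExtensionDatum

variable {N H E : Type*} [Group N] [Group H] [Group E] {k : ℕ} {s : Fin k → H}
  {ι : N →* E} {π : E →* H} {t : Fin k → E}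

theorem IsExtensionDatum.apply_lift (h : IsExtensionDatum s ι π t) (w : FreeGroup (Fin k)) :
    π (FreeGroup.lift t w) = FreeGroup.lift s w := by
  have : π.comp (FreeGroup.lift t) = FreeGroup.lift s := by
    ext i
    simp [h.2.2.2.2 i]
  exact DFunLike.congr_fun this w

/-- The evaluation of relators in an extension, as a homomorphism to `N`. -/
theorem IsExtensionDatum.exists_relator_hom (h : IsExtensionDatum s ι π t) :
    ∃ ρ : (FreeGroup.lift s).ker →* N, ∀ w, ι (ρ w) = FreeGroup.lift t (w : FreeGroup (Fin k)) := by
  have hw : ∀ w : (FreeGroup.lift s).ker,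
      ((FreeGroup.lift t).comp (FreeGroup.lift s).ker.subtype) w ∈ ι.range := by
    intro w
    rw [← h.2.2.2.1, MonoidHom.mem_ker]
    exact (h.apply_lift w).trans w.2
  refine ⟨(MonoidHom.ofInjective h.1).symm.toMonoidHom.comp
    (((FreeGroup.lift t).comp (FreeGroup.lift s).ker.subtype).codRestrict _ hw), fun w => ?_⟩
  exact MonoidHom.apply_ofInjective_symm h.1 _

theorem lift_mul_apply_mul_inv {σ : Fin k → MulAut N}
    (ha : ∀ (a : N) (i : Fin k), t i * ι a * (t i)⁻¹ = ι (σ i a)) (w : FreeGroup (Fin k)) (a : N) :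
    FreeGroup.lift t w * ι a * (FreeGroup.lift t w)⁻¹ = ι (FreeGroup.lift σ w a) := by
  induction w using FreeGroup.induction_on generalizing a with
  | C1 => simp
  | of i => simp [ha]
  | inv_of i _ =>
    have := ha ((σ i)⁻¹ a) i
    rw [MulAut.apply_inv_self] at this
    simp only [map_inv, FreeGroup.lift_apply_of, ← this]
    group
  | mul x y hx hy =>
    rw [map_mul (FreeGroup.lift σ), MulAut.mul_apply, ← hx, ← hy, map_mul]
    group

/-- The homomorphism onto an extension from the semidirect product of `N` by the free group. -/
def semidirectLift (ι : N →* E) (t : Fin k → E) {σ : Fin k → MulAut N}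
    (ha : ∀ (a : N) (i : Fin k), t i * ι a * (t i)⁻¹ = ι (σ i a)) :
    N ⋊[FreeGroup.lift σ] FreeGroup (Fin k) →* E :=
  SemidirectProduct.lift ι (FreeGroup.lift t) fun w => by
    ext a
    exact (lift_mul_apply_mul_inv ha w a).symm

theorem semidirectLift_inl {σ : Fin k → MulAut N}
    (ha : ∀ (a : N) (i : Fin k), t i * ι a * (t i)⁻¹ = ι (σ i a)) (a : N) :
    semidirectLift ι t ha (SemidirectProduct.inl a) = ι a :=
  SemidirectProduct.lift_inl _ _ _ _

theorem IsExtensionDatum.semidirectLift_surjective (h : IsExtensionDatum s ι π t)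
    (hs : Function.Surjective (FreeGroup.lift s)) {σ : Fin k → MulAut N}
    (ha : ∀ (a : N) (i : Fin k), t i * ι a * (t i)⁻¹ = ι (σ i a)) :
    Function.Surjective (semidirectLift ι t ha) := by
  intro e
  obtain ⟨w, hw⟩ := hs (π e)
  have : e * (FreeGroup.lift t w)⁻¹ ∈ ι.range := by
    rw [← h.2.2.2.1, MonoidHom.mem_ker, map_mul, map_inv, h.apply_lift, hw, mul_inv_cancel]
  obtain ⟨a, hx⟩ := this
  refine ⟨⟨a, w⟩, ?_⟩
  change ι a * FreeGroup.lift t w = e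
  rw [hx, inv_mul_cancel_right]

theorem IsExtensionDatum.mem_ker_semidirectLift_iff (h : IsExtensionDatum s ι π t)
    {σ : Fin k → MulAut N}
    (ha : ∀ (a : N) (i : Fin k), t i * ι a * (t i)⁻¹ = ι (σ i a))
    {ρ : (FreeGroup.lift s).ker →* N}
    (hρ : ∀ w, ι (ρ w) = FreeGroup.lift t (w : FreeGroup (Fin k)))
    (x : N ⋊[FreeGroup.lift σ] FreeGroup (Fin k)) :
    x ∈ (semidirectLift ι t ha).ker ↔
      ∃ hx : x.right ∈ (FreeGroup.lift s).ker, x.left * ρ ⟨x.right, hx⟩ = 1 := by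
  change ι x.left * FreeGroup.lift t x.right = 1 ↔ _
  constructor
  · intro hx
    have hπ := congrArg π hx
    have hι : π (ι x.left) = 1 := by
      rw [← MonoidHom.mem_ker, h.2.2.2.1]
      exact ⟨_, rfl⟩
    rw [map_mul, hι, h.apply_lift, one_mul, map_one] at hπ
    refine ⟨hπ, h.1 ?_⟩
    rw [map_mul, hρ, map_one]
    exact hx
  · rintro ⟨hx, h1⟩
    rw [← map_one ι, ← h1, map_mul, hρ]

theorem apply_conjNormal_of_relator_hom (hinj : Function.Injective ι) {σ : Fin k → MulAut N}
    (ha : ∀ (a : N) (i : Fin k), t i * ι a * (t i)⁻¹ = ι (σ i a))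
    {ρ : (FreeGroup.lift s).ker →* N}
    (hρ : ∀ w, ι (ρ w) = FreeGroup.lift t (w : FreeGroup (Fin k)))
    (x : FreeGroup (Fin k)) (w : (FreeGroup.lift s).ker) :
    ρ (MulAut.conjNormal x w) = FreeGroup.lift σ x (ρ w) := by
  apply hinj
  rw [← lift_mul_apply_mul_inv ha, hρ, hρ, MulAut.conjNormal_apply]
  simp only [map_mul, map_inv]

theorem mul_mul_inv_of_relator_hom (hinj : Function.Injective ι) {σ : Fin k → MulAut N}
    (ha : ∀ (a : N) (i : Fin k), t i * ι a * (t i)⁻¹ = ι (σ i a))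
    {ρ : (FreeGroup.lift s).ker →* N}
    (hρ : ∀ w, ι (ρ w) = FreeGroup.lift t (w : FreeGroup (Fin k)))
    (w : (FreeGroup.lift s).ker) (a : N) :
    ρ w * a * (ρ w)⁻¹ = FreeGroup.lift σ (w : FreeGroup (Fin k)) a := by
  apply hinj
  rw [← lift_mul_apply_mul_inv ha, map_mul, map_mul, map_inv, hρ]

end ExtensionDatum

/-- Two homomorphisms inducing the same conjugation action on `N` differ by a homomorphism to
the center. -/
def centralQuotient {R N : Type*} [Group R] [Group N] (ρ₁ ρ₂ : R →* N)
    (h : ∀ w a, ρ₁ w * a * (ρ₁ w)⁻¹ = ρ₂ w * a * (ρ₂ w)⁻¹) : R →* Subgroup.center N :=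
  have hc : ∀ w, ρ₁ w * (ρ₂ w)⁻¹ ∈ Subgroup.center N := fun w => by
    rw [Subgroup.mem_center_iff]
    intro g
    have := h w ((ρ₂ w)⁻¹ * g * ρ₂ w)
    rw [show ρ₂ w * ((ρ₂ w)⁻¹ * g * ρ₂ w) * (ρ₂ w)⁻¹ = g by group] at this
    nth_rewrite 1 [← this]
    group
  { toFun := fun w => ⟨ρ₁ w * (ρ₂ w)⁻¹, hc w⟩
    map_one' := by ext; simp
    map_mul' := fun v w => by
      ext
      have := Subgroup.mem_center_iff.mp (hc w) (ρ₂ v)⁻¹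
      simp only [map_mul, mul_inv_rev, Subgroup.coe_mul]
      rw [mul_assoc (ρ₁ v) (ρ₂ v)⁻¹, this]
      group }

/-- Suppose `H = F/R` where `F` is the free group on `k`
generators, the kernel `R` of `FreeGroup.lift s` is the normal closure of at
most `r` elements, every element of `H` is a word of length at most `m` in
`s`, `N` is a finite group with center `Z`, `σ : Fin k → MulAut N`, and
`d = r·λ(|Z|)`. Then there are relators `w₁, …, w_d` of length at most `3m`
such that any two extension data of `N` by `H` realizing the action `σ` and
agreeing (in `N`) on each `w_l` are isomorphic over `N`. -/
theorem extensions_determined_by_few_relators.{u, v}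
    {H : Type*} [Group H] {k : ℕ} (s : Fin k → H)
    (hs : Subgroup.closure (Set.range s) = ⊤)
    (m : ℕ)
    (hm : ∀ h : H, ∃ w : FreeGroup (Fin k),
      FreeGroup.norm w ≤ m ∧ FreeGroup.lift s w = h)
    (r : ℕ) (T : Finset (FreeGroup (Fin k))) (hTr : T.card ≤ r)
    (hR : Subgroup.normalClosure (↑T : Set (FreeGroup (Fin k)))
      = (FreeGroup.lift s).ker)
    {N : Type*} [Group N] [Finite N] (σ : Fin k → MulAut N) :
    ∃ w : Fin (r * primeFactorCount (Nat.card ↥(Subgroup.center N)))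
        → FreeGroup (Fin k),
      (∀ l, FreeGroup.lift s (w l) = 1 ∧ FreeGroup.norm (w l) ≤ 3 * m) ∧
      ∀ (E₁ : Type u) (E₂ : Type v) [Group E₁] [Group E₂]
        (ι₁ : N →* E₁) (π₁ : E₁ →* H) (t₁ : Fin k → E₁)
        (ι₂ : N →* E₂) (π₂ : E₂ →* H) (t₂ : Fin k → E₂),
        IsExtensionDatum s ι₁ π₁ t₁ → IsExtensionDatum s ι₂ π₂ t₂ →
        (∀ (a : N) (i : Fin k), t₁ i * ι₁ a * (t₁ i)⁻¹ = ι₁ (σ i a)) →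
        (∀ (a : N) (i : Fin k), t₂ i * ι₂ a * (t₂ i)⁻¹ = ι₂ (σ i a)) →
        (∀ l, ∃ a : N,
          FreeGroup.lift t₁ (w l) = ι₁ a ∧ FreeGroup.lift t₂ (w l) = ι₂ a) →
        ∃ f : E₁ ≃* E₂, ∀ a : N, f (ι₁ a) = ι₂ a := by
  have hsurj : Function.Surjective (FreeGroup.lift s) := fun h =>
    (hm h).imp fun _ hw => hw.2
  rcases eq_or_ne m 0 with rfl | hm0
  · refine ⟨fun _ => 1, fun l => by simp, ?_⟩
    intro E₁ E₂ _ _ ι₁ π₁ t₁ ι₂ π₂ t₂ h₁ h₂ _ _ _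
    have htriv : ∀ h : H, h = 1 := fun h => by
      obtain ⟨w, hw, rfl⟩ := hm h
      rw [FreeGroup.norm_eq_zero.mp (Nat.le_zero.mp hw), map_one]
    have hsurj₁ : Function.Surjective ι₁ := fun e =>
      (h₁.2.2.2.1 ▸ htriv (π₁ e) : e ∈ ι₁.range)
    have hsurj₂ : Function.Surjective ι₂ := fun e =>
      (h₂.2.2.2.1 ▸ htriv (π₂ e) : e ∈ ι₂.range)
    let e₁ := MulEquiv.ofBijective ι₁ ⟨h₁.1, hsurj₁⟩
    let e₂ := MulEquiv.ofBijective ι₂ ⟨h₂.1, hsurj₂⟩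
    exact ⟨e₁.symm.trans e₂, fun a => congrArg e₂ (e₁.symm_apply_apply a)⟩
  obtain ⟨hfin, hcard⟩ := equivariantHoms_finite_and_cardFactors_le (FreeGroup.lift σ) hR
  let I := {w : FreeGroup (Fin k) // FreeGroup.lift s w = 1 ∧ FreeGroup.norm w ≤ 3 * m}
  have : Nonempty I := ⟨⟨1, by simp⟩⟩
  let K : I → Subgroup ((FreeGroup.lift s).ker →* Subgroup.center N) := fun w =>
    (evalHom fun _ : Unit => (⟨w.1, w.2.1⟩ : (FreeGroup.lift s).ker)).ker
  have mem_K : ∀ (w : I) δ, δ ∈ K w ↔ δ ⟨w.1, w.2.1⟩ = 1 := fun w δ =>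
    ⟨fun h => congrFun h (), fun h => funext fun _ => h⟩
  obtain ⟨w, hw⟩ := exists_subfamily_forall_mem K
    (r * primeFactorCount (Nat.card ↥(Subgroup.center N))) _
    (hcard.trans (Nat.mul_le_mul_right _ hTr))
  refine ⟨fun l => (w l).1, fun l => (w l).2, ?_⟩
  intro E₁ E₂ _ _ ι₁ π₁ t₁ ι₂ π₂ t₂ h₁ h₂ ha₁ ha₂ hwl
  obtain ⟨ρ₁, hρ₁⟩ := h₁.exists_relator_hom
  obtain ⟨ρ₂, hρ₂⟩ := h₂.exists_relator_hom
  have hconj : ∀ w a, ρ₁ w * a * (ρ₁ w)⁻¹ = ρ₂ w * a * (ρ₂ w)⁻¹ := fun w a => by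
    rw [mul_mul_inv_of_relator_hom h₁.1 ha₁ hρ₁, mul_mul_inv_of_relator_hom h₂.1 ha₂ hρ₂]
  let δ := centralQuotient ρ₁ ρ₂ hconj
  have coe_δ : ∀ w, (δ w : N) = ρ₁ w * (ρ₂ w)⁻¹ := fun _ => rfl
  have hδ : δ ∈ equivariantHoms (FreeGroup.lift s).ker (FreeGroup.lift σ) := fun x w => by
    rw [coe_δ, coe_δ, apply_conjNormal_of_relator_hom h₁.1 ha₁ hρ₁,
      apply_conjNormal_of_relator_hom h₂.1 ha₂ hρ₂, map_mul, map_inv]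
  have hδK : ∀ l, δ ∈ K (w l) := fun l => by
    rw [mem_K]
    obtain ⟨a, hl₁, hl₂⟩ := hwl l
    ext
    rw [coe_δ, h₁.1 ((hρ₁ _).trans hl₁), h₂.1 ((hρ₂ _).trans hl₂), mul_inv_cancel,
      Subgroup.coe_one]
  have hδ1 : δ = 1 := by
    refine eq_one_of_le_map_ker (ker_lift_le_of_norm_le s hm0 hm _ fun v hv hvm => ?_)
    exact ⟨⟨v, hv⟩, (mem_K ⟨v, hv, hvm⟩ δ).mp (hw δ hδ hδK _), rfl⟩
  have hρ : ρ₁ = ρ₂ := by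
    ext v
    have := coe_δ v
    rw [hδ1] at this
    exact mul_inv_eq_one.mp this.symm
  subst hρ
  have hker : (semidirectLift ι₁ t₁ ha₁).ker = (semidirectLift ι₂ t₂ ha₂).ker := by
    ext x
    rw [h₁.mem_ker_semidirectLift_iff ha₁ hρ₁, h₂.mem_ker_semidirectLift_iff ha₂ hρ₂]
  let e₁ := QuotientGroup.quotientKerEquivOfSurjective _ (h₁.semidirectLift_surjective hsurj ha₁)
  let e₂ := QuotientGroup.quotientKerEquivOfSurjective _ (h₂.semidirectLift_surjective hsurj ha₂)
  refine ⟨(e₁.symm.trans (QuotientGroup.quotientMulEquivOfEq hker)).trans e₂, fun a => ?_⟩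
  have he₁ : e₁ (QuotientGroup.mk (SemidirectProduct.inl a)) = ι₁ a :=
    semidirectLift_inl ha₁ a
  have he₂ : e₂ (QuotientGroup.mk (SemidirectProduct.inl a)) = ι₂ a :=
    semidirectLift_inl ha₂ a
  rw [MulEquiv.trans_apply, MulEquiv.trans_apply, ← he₁, MulEquiv.symm_apply_apply, ← he₂]
  rfl
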